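/- arXiv:math/0512080 — 3 statements merged into one kernel-verified Lean document; each statement's English description precedes it below -/
import Mathlib

section
/- For every λ ∈ [0,1] and every t > 0, ∫_{ℝ∖[−t(1−λ)/2, t(1−λ)/2]} (t/(π(λt² + x²)))·(1 − t²(1−λ)²/(4x²))^{1/2} dx = 1; that is, the function x ↦ (t/(π(λt² + x²)))·(1 − t²(1−λ)²/(4x²))^{1/2}, defined for |x| ≥ t(1−λ)/2 and zero elsewhere, is a probability density on ℝ. (The corresponding measure ν_t is the image of the symmetric Cauchy law with parameter t under the rectangular Bercovici–Pata bijection with ratio λ; its support is ℝ∖(−t(1−λ)/2, t(1−λ)/2).) -/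
open MeasureTheory Real

/-- Density of the rectangular analogue `ν_t` of the Cauchy distribution (ratio `λ`):
`x ↦ (t/(π(λt² + x²)))·√(1 − t²(1−λ)²/(4x²))` on `ℝ ∖ [−t(1−λ)/2, t(1−λ)/2]`,
and `0` on `[−t(1−λ)/2, t(1−λ)/2]`. -/
noncomputable def rcDensity (l t x : ℝ) : ℝ :=
  if t * (1 - l) / 2 < |x| then
    t / (Real.pi * (l * t^2 + x^2)) * Real.sqrt (1 - t^2 * (1 - l)^2 / (4 * x^2))
  else 0

open Filter Topology in
/-- A primitive on `(0, ∞)` of `u ↦ u² / ((u² + a²)(u² + b²))`, with its limits at both ends. -/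
lemma exists_primitive_sq_div_mul {a b : ℝ} (ha : 0 ≤ a) (hab : a ≤ b) (hb : 0 < b) :
    ∃ G : ℝ → ℝ, Continuous G ∧ G 0 = 0 ∧
      (∀ u, 0 < u → HasDerivAt G (u ^ 2 / ((u ^ 2 + a ^ 2) * (u ^ 2 + b ^ 2))) u) ∧
      Tendsto G atTop (𝓝 (π / (2 * (a + b)))) := by
  have hdiv {c : ℝ} (hc : 0 < c) : Tendsto (fun u : ℝ => arctan (u / c)) atTop (𝓝 (π / 2)) :=
    (tendsto_arctan_atTop.mono_right nhdsWithin_le_nhds).comp (tendsto_id.atTop_div_const hc)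
  have hderiv {c : ℝ} (hc : 0 < c) (u : ℝ) :
      HasDerivAt (fun u : ℝ => c * arctan (u / c)) (c ^ 2 / (u ^ 2 + c ^ 2)) u := by
    refine ((((hasDerivAt_id u).div_const c).arctan).const_mul c).congr_deriv ?_
    simp only [id]
    field_simp
    ring
  rcases hab.eq_or_lt with rfl | hlt
  · refine ⟨fun u => (a * arctan (u / a)) / (2 * a ^ 2) - u / (2 * (u ^ 2 + a ^ 2)), ?_, by simp,
      fun u hu => ?_, ?_⟩
    · have h : ∀ u : ℝ, 2 * (u ^ 2 + a ^ 2) ≠ 0 := fun u => by positivity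
      fun_prop (disch := exact h _)
    · have h : 2 * (u ^ 2 + a ^ 2) ≠ 0 := by positivity
      have hq : HasDerivAt (fun u : ℝ => 2 * (u ^ 2 + a ^ 2)) (2 * (2 * u)) u := by
        simpa using ((hasDerivAt_pow 2 u).add_const (a ^ 2)).const_mul 2
      refine (((hderiv hb u).div_const (2 * a ^ 2)).sub
        ((hasDerivAt_id u).div hq h)).congr_deriv ?_
      simp only [id]
      field_simp
      ring
    · have h0 : Tendsto (fun u : ℝ => u / (2 * (u ^ 2 + a ^ 2))) atTop (𝓝 0) := by
        refine squeeze_zero' (g := fun u => u⁻¹) ?_ ?_ tendsto_inv_atTop_zero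
        · filter_upwards [eventually_gt_atTop 0] with u hu
          positivity
        · filter_upwards [eventually_gt_atTop 0] with u hu
          rw [div_le_iff₀ (by positivity)]
          field_simp
          nlinarith
      convert (((hdiv hb).const_mul a).div_const (2 * a ^ 2)).sub h0 using 2
      field_simp
      ring
  · have hne : b ^ 2 - a ^ 2 ≠ 0 := by nlinarith
    refine ⟨fun u => (b * arctan (u / b) - a * arctan (u / a)) / (b ^ 2 - a ^ 2), by fun_prop,
      by simp, fun u hu => ?_, ?_⟩
    · have hA : HasDerivAt (fun u : ℝ => a * arctan (u / a)) (a ^ 2 / (u ^ 2 + a ^ 2)) u := by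
        rcases ha.eq_or_lt with rfl | ha
        · simpa using hasDerivAt_const u (0 : ℝ)
        · exact hderiv ha u
      refine (((hderiv hb u).sub hA).div_const (b ^ 2 - a ^ 2)).congr_deriv ?_
      field_simp
      ring
    · have hA : Tendsto (fun u : ℝ => a * arctan (u / a)) atTop (𝓝 (a * (π / 2))) := by
        rcases ha.eq_or_lt with rfl | ha
        · simp
        · exact (hdiv ha).const_mul a
      convert (((hdiv hb).const_mul b).sub hA).div_const (b ^ 2 - a ^ 2) using 2
      have : a + b ≠ 0 := by positivity
      field_simp
      ring

open Filter Topology in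
lemma integral_Ioi_sqrt_div {a b : ℝ} (ha : 0 ≤ a) (hab : a ≤ b) (hb : 0 < b) :
    ∫ x in Set.Ioi a, √(1 - a ^ 2 / x ^ 2) / (x ^ 2 + (b ^ 2 - a ^ 2)) =
      π / (2 * (a + b)) := by
  obtain ⟨G, hGc, hG0, hGd, hGt⟩ := exists_primitive_sq_div_mul ha hab hb
  have key := integral_Ioi_of_hasDerivAt_of_nonneg (a := a) (g := fun x => G √(x ^ 2 - a ^ 2))
    (g' := fun x => √(1 - a ^ 2 / x ^ 2) / (x ^ 2 + (b ^ 2 - a ^ 2))) (l := π / (2 * (a + b)))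
    (by fun_prop) (fun x hx => ?_) (fun x _ => ?_) (hGt.comp ?_)
  · simpa [hG0] using key
  · have hxa : a < x := hx
    have hx0 : 0 < x := ha.trans_lt hxa
    have hpos : 0 < x ^ 2 - a ^ 2 := by nlinarith
    have hu : 0 < √(x ^ 2 - a ^ 2) := Real.sqrt_pos.2 hpos
    have hp : HasDerivAt (fun x : ℝ => x ^ 2 - a ^ 2) (2 * x) x := by
      simpa using (hasDerivAt_pow 2 x).sub_const (a ^ 2)
    have hcomp := (hGd _ hu).comp x (hp.sqrt hpos.ne')
    have hs : √(1 - a ^ 2 / x ^ 2) = √(x ^ 2 - a ^ 2) / x := by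
      rw [one_sub_div (by positivity), Real.sqrt_div hpos.le, Real.sqrt_sq hx0.le]
    refine hcomp.congr_deriv ?_
    have hden : 0 < x ^ 2 + (b ^ 2 - a ^ 2) := by nlinarith
    symm
    rw [hs, Real.sq_sqrt hpos.le,
      show x ^ 2 - a ^ 2 + b ^ 2 = x ^ 2 + (b ^ 2 - a ^ 2) by ring, sub_add_cancel,
      div_mul_div_comm, div_div, div_eq_div_iff (by positivity) (by positivity)]
    linear_combination (2 * x ^ 2 * (x ^ 2 + (b ^ 2 - a ^ 2))) * Real.sq_sqrt hpos.le
  · have : 0 ≤ b ^ 2 - a ^ 2 := by nlinarith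
    positivity
  · exact Real.tendsto_sqrt_atTop.comp
      (tendsto_atTop_add_const_right _ _ (tendsto_pow_atTop two_ne_zero))

lemma rcDensity_nonneg {l t : ℝ} (hl : 0 ≤ l) (ht : 0 ≤ t) (x : ℝ) : 0 ≤ rcDensity l t x := by
  unfold rcDensity
  split_ifs <;> positivity

lemma rcDensity_abs (l t x : ℝ) : rcDensity l t |x| = rcDensity l t x := by
  simp [rcDensity]

lemma rcDensity_eq_indicator (l t : ℝ) :
    rcDensity l t = (Set.Icc (-(t * (1 - l) / 2)) (t * (1 - l) / 2))ᶜ.indicator fun x =>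
      t / (π * (l * t ^ 2 + x ^ 2)) * √(1 - t ^ 2 * (1 - l) ^ 2 / (4 * x ^ 2)) := by
  ext x
  simp only [rcDensity, Set.indicator_apply, Set.mem_compl_iff, Set.mem_Icc, ← abs_le, not_le]

lemma integral_rcDensity {l t : ℝ} (hl : l ∈ Set.Icc (0 : ℝ) 1) (ht : 0 < t) :
    ∫ x, rcDensity l t x = 1 := by
  obtain ⟨hl0, hl1⟩ := hl
  have ha : 0 ≤ t * (1 - l) / 2 := by
    have := sub_nonneg.2 hl1
    positivity
  have hhalf : ∫ x in Set.Ioi 0, rcDensity l t x =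
      ∫ x in Set.Ioi (t * (1 - l) / 2), t / π * (√(1 - (t * (1 - l) / 2) ^ 2 / x ^ 2) /
        (x ^ 2 + ((t * (1 + l) / 2) ^ 2 - (t * (1 - l) / 2) ^ 2))) := by
    rw [← integral_indicator measurableSet_Ioi, ← integral_indicator measurableSet_Ioi]
    congr 1 with x
    by_cases hx : t * (1 - l) / 2 < x
    · have hx0 : 0 < x := ha.trans_lt hx
      rw [Set.indicator_of_mem (Set.mem_Ioi.2 hx0), Set.indicator_of_mem (Set.mem_Ioi.2 hx),
        rcDensity, if_pos (by rwa [abs_of_pos hx0]),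
        show t ^ 2 * (1 - l) ^ 2 / (4 * x ^ 2) = (t * (1 - l) / 2) ^ 2 / x ^ 2 by
          field_simp; ring,
        show x ^ 2 + ((t * (1 + l) / 2) ^ 2 - (t * (1 - l) / 2) ^ 2) = l * t ^ 2 + x ^ 2 by ring]
      field_simp
    · rw [Set.indicator_of_notMem (s := Set.Ioi (t * (1 - l) / 2)) hx]
      refine Set.indicator_apply_eq_zero.2 fun hx0 => ?_
      rw [rcDensity, if_neg (by rwa [abs_of_pos hx0])]
  calc ∫ x, rcDensity l t x = ∫ x, rcDensity l t |x| := by simp only [rcDensity_abs]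
    _ = 2 * ∫ x in Set.Ioi 0, rcDensity l t x := integral_comp_abs
    _ = 1 := by
      rw [hhalf, integral_const_mul,
        integral_Ioi_sqrt_div ha (by nlinarith) (by positivity),
        show t * (1 - l) / 2 + t * (1 + l) / 2 = t by ring]
      field_simp

/-- for `λ ∈ [0,1]` and `t > 0`,
`∫_{ℝ∖[−t(1−λ)/2, t(1−λ)/2]} (t/(π(λt²+x²)))·√(1 − t²(1−λ)²/(4x²)) dx = 1`,
i.e. the function above is a probability density on `ℝ`. -/
theorem stmt11 (l : ℝ) (hl : l ∈ Set.Icc (0:ℝ) 1) (t : ℝ) (ht : 0 < t) :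
    (∀ x : ℝ, 0 ≤ rcDensity l t x) ∧
    (∫ x in (Set.Icc (-(t * (1 - l) / 2)) (t * (1 - l) / 2))ᶜ,
        t / (Real.pi * (l * t^2 + x^2)) * Real.sqrt (1 - t^2 * (1 - l)^2 / (4 * x^2)) = 1) ∧
    (∫ x, rcDensity l t x = 1) := by
  refine ⟨rcDensity_nonneg hl.1 ht.le, ?_, integral_rcDensity hl ht⟩
  rw [← integral_indicator measurableSet_Icc.compl, ← rcDensity_eq_indicator]
  exact integral_rcDensity hl ht
end

section
/- Let (ν_n) be a sequence of symmetric probability measures on ℝ, let (k_n) be a sequence of positive integers tending to infinity, and for each n let ρ_n be the pushforward of ν_n by the map t ↦ t². Then the sequence (ν_n^{*k_n}) of convolution powers converges weakly to some probability measure if and only if the sequence (ρ_n^{*k_n}) converges weakly to some probability measure. -/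
open MeasureTheory Filter

/-- Classical convolution of two measures on `ℝ`. -/
noncomputable def mconv (μ ν : Measure ℝ) : Measure ℝ :=
  (μ.prod ν).map (fun p => p.1 + p.2)

/-- `n`-fold classical convolution power (`convPow μ 0 = δ_0`). -/
noncomputable def convPow (μ : Measure ℝ) : ℕ → Measure ℝ
  | 0 => Measure.dirac 0
  | n + 1 => mconv (convPow μ n) μ

/-- Weak convergence of a sequence of measures on `ℝ`: convergence of integrals of all
bounded continuous functions. -/
def WeakTendsto (μs : ℕ → Measure ℝ) (μ : Measure ℝ) : Prop :=
  ∀ f : BoundedContinuousFunction ℝ ℝ,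
    Tendsto (fun n => ∫ x, f x ∂(μs n)) atTop (nhds (∫ x, f x ∂μ))

open Topology ProbabilityTheory

/-! ### Elementary real inequalities -/

lemma div_one_add_le_one_sub_exp_neg {y : ℝ} (hy : 0 ≤ y) : y / (1 + y) ≤ 1 - Real.exp (-y) := by
  have h1 : Real.exp (-y) ≤ 1 / (1 + y) := by
    rw [Real.exp_neg, inv_eq_one_div]
    exact one_div_le_one_div_of_le (by linarith) (by linarith [Real.add_one_le_exp y])
  have h2 : y / (1 + y) = 1 - 1 / (1 + y) := by field_simp; ring
  linarith

lemma le_mul_one_sub_exp_neg {x y c : ℝ} (hy : 0 ≤ y) (hc : 0 ≤ c) (h1 : x ≤ c * y) (h2 : x ≤ c) :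
    x ≤ 2 * c * (1 - Real.exp (-y)) := by
  have h3 : x ≤ 2 * c * (y / (1 + y)) := by
    rw [← mul_div_assoc, le_div_iff₀ (by linarith)]
    rcases le_total x 0 with hx | hx
    · nlinarith [mul_nonneg hc hy]
    · nlinarith
  exact h3.trans (mul_le_mul_of_nonneg_left (div_one_add_le_one_sub_exp_neg hy) (by linarith))

lemma one_sub_exp_neg_mul_le {a u : ℝ} (ha : 0 ≤ a) (hu : 0 ≤ u) :
    1 - Real.exp (-(a * u)) ≤ 2 * (1 + a) * (1 - Real.exp (-u)) := by
  apply le_mul_one_sub_exp_neg hu (by linarith)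
  · have := Real.add_one_le_exp (-(a * u))
    nlinarith
  · linarith [Real.exp_pos (-(a * u))]

lemma one_sub_cos_le_mul_one_sub_exp_neg_sq (x : ℝ) :
    1 - Real.cos x ≤ 4 * (1 - Real.exp (-x ^ 2)) := by
  have := le_mul_one_sub_exp_neg (x := 1 - Real.cos x) (c := 2) (sq_nonneg x) (by norm_num)
    (by nlinarith [Real.one_sub_sq_div_two_le_cos (x := x)]) (by linarith [Real.neg_one_le_cos x])
  linarith

lemma norm_cexp_mul_I_sub_one_le (y : ℝ) :
    ‖Complex.exp (y * Complex.I) - 1‖ ≤ 4 * (1 - Real.exp (-|y|)) := by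
  have h1 : ‖Complex.exp (y * Complex.I) - 1‖ ≤ |y| := by
    have := Real.norm_exp_I_mul_ofReal_sub_one_le (x := y)
    rwa [mul_comm, Real.norm_eq_abs] at this
  have h2 : ‖Complex.exp (y * Complex.I) - 1‖ ≤ 2 := by
    refine (norm_sub_le _ _).trans ?_
    rw [Complex.norm_exp_ofReal_mul_I]
    norm_num
  have := le_mul_one_sub_exp_neg (c := 2) (abs_nonneg y) (by norm_num)
    (by linarith [abs_nonneg y]) h2
  linarith

lemma abs_sin_natCast_mul_le (N : ℕ) (y : ℝ) : |Real.sin (N * y)| ≤ N * |Real.sin y| := by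
  induction N with
  | zero => simp
  | succ N ih =>
    have : ((N + 1 : ℕ) : ℝ) * y = N * y + y := by push_cast; ring
    rw [this, Real.sin_add]
    refine (abs_add_le _ _).trans ?_
    rw [abs_mul, abs_mul]
    push_cast
    nlinarith [Real.abs_cos_le_one y, Real.abs_cos_le_one (N * y), abs_nonneg (Real.sin (N * y)),
      abs_nonneg (Real.sin y)]

lemma one_sub_cos_eq_two_mul_sin_sq (x : ℝ) : 1 - Real.cos x = 2 * Real.sin (x / 2) ^ 2 := by
  have := Real.cos_two_mul (x / 2)
  rw [mul_div_cancel₀ x two_ne_zero] at this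
  nlinarith [Real.sin_sq_add_cos_sq (x / 2)]

lemma one_sub_cos_natCast_mul_le (N : ℕ) (x : ℝ) :
    1 - Real.cos (N * x) ≤ N ^ 2 * (1 - Real.cos x) := by
  rw [one_sub_cos_eq_two_mul_sin_sq, one_sub_cos_eq_two_mul_sin_sq, mul_div_assoc]
  have h := abs_sin_natCast_mul_le N (x / 2)
  have := pow_le_pow_left₀ (abs_nonneg _) h 2
  rw [mul_pow, sq_abs, sq_abs] at this
  linarith

lemma sin_eq_mul_sinc (x : ℝ) : Real.sin x = x * Real.sinc x := by
  rcases eq_or_ne x 0 with rfl | hx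
  · simp
  · rw [Real.sinc_of_ne_zero hx]; field_simp

/-! ### Limits of powers -/

section Powers

variable {𝕜 : Type*} [RCLike 𝕜] {k : ℕ → ℕ}

lemma tendsto_zero_of_tendsto_natCast_mul (hk : Tendsto k atTop atTop) {w : ℕ → 𝕜} {z : 𝕜}
    (h : Tendsto (fun n => (k n : 𝕜) * w n) atTop (𝓝 z)) : Tendsto w atTop (𝓝 0) := by
  have h1 : Tendsto (fun n => ((k n : 𝕜))⁻¹) atTop (𝓝 0) :=
    (tendsto_inv_atTop_nhds_zero_nat (𝕜 := 𝕜)).comp hk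
  have h2 := h1.mul h
  rw [zero_mul] at h2
  refine h2.congr' ?_
  filter_upwards [hk.eventually_ge_atTop 1] with n hn
  have : (k n : 𝕜) ≠ 0 := by exact_mod_cast (by omega : k n ≠ 0)
  field_simp

lemma tendsto_natCast_mul_comp (hk : Tendsto k atTop atTop) {f : 𝕜 → 𝕜} (hf0 : f 0 = 0)
    (hf : HasDerivAt f 1 0) {w : ℕ → 𝕜} {z : 𝕜}
    (h : Tendsto (fun n => (k n : 𝕜) * w n) atTop (𝓝 z)) :
    Tendsto (fun n => (k n : 𝕜) * f (w n)) atTop (𝓝 z) := by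
  have hw := tendsto_zero_of_tendsto_natCast_mul hk h
  have hc : ContinuousAt (dslope f 0) 0 := continuousAt_dslope_same.2 hf.differentiableAt
  have h1 := hc.tendsto.comp hw
  rw [dslope_same, hf.deriv] at h1
  have h2 := h.mul h1
  rw [mul_one] at h2
  refine h2.congr fun n => ?_
  have := sub_smul_dslope f 0 (w n)
  simp only [sub_zero, smul_eq_mul, hf0] at this
  rw [Function.comp_apply, mul_assoc, this]

lemma tendsto_pow_cexp_of_tendsto (hk : Tendsto k atTop atTop) {x : ℕ → ℂ} {z : ℂ}
    (h : Tendsto (fun n => (k n : ℂ) * (x n - 1)) atTop (𝓝 z)) :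
    Tendsto (fun n => x n ^ k n) atTop (𝓝 (Complex.exp z)) := by
  have hw := tendsto_zero_of_tendsto_natCast_mul hk h
  have hd : HasDerivAt (fun w : ℂ => Complex.log (1 + w)) 1 0 := by
    have := ((hasDerivAt_id (0 : ℂ)).const_add 1).clog (by simp)
    simpa using this
  have h1 := tendsto_natCast_mul_comp hk (by simp) hd h
  refine ((Complex.continuous_exp.tendsto z).comp h1).congr' ?_
  have hne : ∀ᶠ n in atTop, x n - 1 ≠ -1 := hw.eventually_ne (by norm_num)
  filter_upwards [hne] with n hn
  have : x n ≠ 0 := fun h0 => hn (by rw [h0]; ring)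
  simp only [Function.comp_apply, add_sub_cancel]
  rw [Complex.exp_nat_mul, Complex.exp_log this]

lemma tendsto_natCast_mul_one_sub_of_tendsto_pow (hk : Tendsto k atTop atTop) {x : ℕ → ℝ} {l : ℝ}
    (hl : 0 < l) (hx : ∀ᶠ n in atTop, 0 < x n) (h : Tendsto (fun n => x n ^ k n) atTop (𝓝 l)) :
    Tendsto (fun n => (k n : ℝ) * (1 - x n)) atTop (𝓝 (-Real.log l)) := by
  have h1 : Tendsto (fun n => (k n : ℝ) * Real.log (x n)) atTop (𝓝 (Real.log l)) := by
    refine ((Real.continuousAt_log hl.ne').tendsto.comp h).congr fun n => ?_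
    simp
  have hd : HasDerivAt (fun y : ℝ => Real.exp y - 1) 1 0 := by
    simpa using (Real.hasDerivAt_exp 0).sub_const 1
  have h2 := (tendsto_natCast_mul_comp (𝕜 := ℝ) hk (by simp) hd h1).neg
  refine h2.congr' ?_
  filter_upwards [hx] with n hn
  simp only [Real.exp_log hn]
  ring

end Powers

/-! ### Convolution powers -/

section ConvPow

variable (μ : Measure ℝ) [IsProbabilityMeasure μ]

instance isProbabilityMeasure_convPow (k : ℕ) : IsProbabilityMeasure (convPow μ k) := by
  induction k with
  | zero => rw [convPow]; infer_instance
  | succ k ih =>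
    rw [convPow, mconv]
    exact Measure.isProbabilityMeasure_map (by fun_prop)

lemma integral_convPow_of_map_add {𝕜 : Type*} [RCLike 𝕜] {e : ℝ → 𝕜} (he : Continuous e)
    (h0 : e 0 = 1) (hadd : ∀ x y, e (x + y) = e x * e y) (k : ℕ) :
    ∫ x, e x ∂(convPow μ k) = (∫ x, e x ∂μ) ^ k := by
  induction k with
  | zero => rw [convPow]; simp [h0]
  | succ k ih =>
    rw [convPow, mconv, integral_map (by fun_prop) he.aestronglyMeasurable]
    simp_rw [hadd]
    rw [integral_prod_mul, ih, pow_succ]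

lemma charFun_convPow (k : ℕ) (s : ℝ) : charFun (convPow μ k) s = charFun μ s ^ k := by
  simp_rw [charFun_apply_real]
  apply integral_convPow_of_map_add
  · fun_prop
  · simp
  · intro x y
    rw [← Complex.exp_add]
    push_cast
    ring_nf

end ConvPow

lemma ae_nonneg_convPow {μ : Measure ℝ} (h : ∀ᵐ x ∂μ, 0 ≤ x) (k : ℕ) : ∀ᵐ x ∂(convPow μ k), 0 ≤ x := by
  induction k with
  | zero => rw [convPow, ae_dirac_iff measurableSet_Ici]
  | succ k ih =>
    rw [convPow, mconv, ae_map_iff (by fun_prop) measurableSet_Ici]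
    have h1 : ∀ᵐ p ∂((convPow μ k).prod μ), 0 ≤ p.1 := Measure.quasiMeasurePreserving_fst.ae ih
    have h2 : ∀ᵐ p ∂((convPow μ k).prod μ), 0 ≤ p.2 := Measure.quasiMeasurePreserving_snd.ae h
    filter_upwards [h1, h2] with p hp1 hp2
    exact add_nonneg hp1 hp2


/-! ### Characteristic functions and weak convergence -/

lemma integrable_of_continuous_of_abs_le {μ : Measure ℝ} [IsFiniteMeasure μ] {f : ℝ → ℝ}
    (hf : Continuous f) (C : ℝ) (h : ∀ x, |f x| ≤ C) : Integrable f μ :=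
  Integrable.of_bound hf.aestronglyMeasurable C (ae_of_all _ h)

lemma integrable_cos_mul (μ : Measure ℝ) [IsFiniteMeasure μ] (s : ℝ) :
    Integrable (fun x => Real.cos (s * x)) μ :=
  integrable_of_continuous_of_abs_le (by fun_prop) 1 fun _ => Real.abs_cos_le_one _

lemma integrable_cexp_mul_mul_I (μ : Measure ℝ) [IsFiniteMeasure μ] (s : ℝ) :
    Integrable (fun x : ℝ => Complex.exp (s * x * Complex.I)) μ :=
  Integrable.of_bound (by fun_prop) 1 (ae_of_all _ fun x => by
    rw [← Complex.ofReal_mul, Complex.norm_exp_ofReal_mul_I])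

lemma re_charFun (μ : Measure ℝ) [IsFiniteMeasure μ] (s : ℝ) :
    (charFun μ s).re = ∫ x, Real.cos (s * x) ∂μ := by
  rw [charFun_apply_real]
  have := integral_re (𝕜 := ℂ) (integrable_cexp_mul_mul_I μ s)
  simp only [RCLike.re_to_complex] at this
  rw [← this]
  congr 1 with x
  rw [← Complex.ofReal_mul, Complex.exp_ofReal_mul_I_re]

lemma charFun_eq_integral_cos_of_symm {μ : Measure ℝ} [IsFiniteMeasure μ]
    (h : μ.map (fun x => -x) = μ) (s : ℝ) :
    charFun μ s = ((∫ x, Real.cos (s * x) ∂μ : ℝ) : ℂ) := by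
  rw [← re_charFun]
  symm
  rw [← Complex.conj_eq_iff_re, ← charFun_neg]
  conv_rhs => rw [← h]
  have := charFun_map_mul (μ := μ) (-1) s
  simp only [neg_mul, one_mul] at this
  exact this.symm

lemma WeakTendsto.tendsto_integral {μs : ℕ → Measure ℝ} {μ : Measure ℝ} (h : WeakTendsto μs μ)
    {f : ℝ → ℝ} (hf : Continuous f) (C : ℝ) (hC : ∀ x, |f x| ≤ C) :
    Tendsto (fun n => ∫ x, f x ∂(μs n)) atTop (𝓝 (∫ x, f x ∂μ)) :=
  h (BoundedContinuousFunction.ofNormedAddCommGroup f hf C hC)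

lemma exists_weakTendsto_of_tendsto_charFun {μs : ℕ → Measure ℝ}
    [hμs : ∀ n, IsProbabilityMeasure (μs n)] {f : ℝ → ℂ} (hf : ContinuousAt f 0)
    (h : ∀ s, Tendsto (fun n => charFun (μs n) s) atTop (𝓝 (f s))) :
    ∃ μ : Measure ℝ, IsProbabilityMeasure μ ∧ WeakTendsto μs μ := by
  let P : ℕ → ProbabilityMeasure ℝ := fun n => ⟨μs n, hμs n⟩
  have ht : IsTightMeasureSet (Set.range μs) := isTightMeasureSet_of_tendsto_charFun hf h
  have hc : IsCompact (closure (Set.range P)) := by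
    apply isCompact_closure_of_isTightMeasureSet
    convert ht
    ext m
    constructor
    · rintro ⟨_, ⟨n, rfl⟩, rfl⟩
      exact ⟨n, rfl⟩
    · rintro ⟨n, rfl⟩
      exact ⟨P n, ⟨n, rfl⟩, rfl⟩
  obtain ⟨μ, -, φ, hφ, hlim⟩ := hc.tendsto_subseq fun n => subset_closure (Set.mem_range_self n)
  have hchar : ∀ s, charFun (μ : Measure ℝ) s = f s := fun s =>
    tendsto_nhds_unique (ProbabilityMeasure.tendsto_iff_tendsto_charFun.1 hlim s)
      ((h s).comp hφ.tendsto_atTop)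
  have hP : Tendsto P atTop (𝓝 μ) :=
    ProbabilityMeasure.tendsto_of_tendsto_charFun fun s => by rw [hchar]; exact h s
  exact ⟨μ, μ.2, ProbabilityMeasure.tendsto_iff_forall_integral_tendsto.1 hP⟩

lemma exists_weakTendsto_convPow {μ : ℕ → Measure ℝ} [∀ n, IsProbabilityMeasure (μ n)]
    {k : ℕ → ℕ} (hk : Tendsto k atTop atTop) {z : ℝ → ℂ} (hz : ContinuousAt z 0)
    (h : ∀ s, Tendsto (fun n => (k n : ℂ) * (charFun (μ n) s - 1)) atTop (𝓝 (z s))) :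
    ∃ μ' : Measure ℝ, IsProbabilityMeasure μ' ∧ WeakTendsto (fun n => convPow (μ n) (k n)) μ' := by
  refine exists_weakTendsto_of_tendsto_charFun (f := fun s => Complex.exp (z s)) hz.cexp fun s => ?_
  simp_rw [charFun_convPow]
  exact tendsto_pow_cexp_of_tendsto hk (h s)

/-! ### From Laplace exponents to general test functions -/

lemma exists_tendsto_of_forall_approx {a : ℕ → ℝ}
    (h : ∀ ε > 0, ∃ b : ℕ → ℝ, (∃ l, Tendsto b atTop (𝓝 l)) ∧ ∀ᶠ n in atTop, |a n - b n| ≤ ε) :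
    ∃ l, Tendsto a atTop (𝓝 l) := by
  apply cauchySeq_tendsto_of_complete
  rw [Metric.cauchySeq_iff]
  intro ε hε
  obtain ⟨b, ⟨l, hb⟩, hab⟩ := h (ε / 8) (by positivity)
  have hb' : ∀ᶠ n in atTop, |b n - l| < ε / 8 := by
    simpa [Real.dist_eq] using Metric.tendsto_nhds.1 hb (ε / 8) (by positivity)
  obtain ⟨N, hN⟩ := eventually_atTop.1 (hab.and hb')
  refine ⟨N, fun m hm n hn => ?_⟩
  have h1 := hN m hm
  have h2 := hN n hn
  rw [abs_le, abs_lt] at h1 h2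
  rw [Real.dist_eq, abs_lt]
  constructor <;> linarith [h1.1.1, h1.1.2, h1.2.1, h1.2.2, h2.1.1, h2.1.2, h2.2.1, h2.2.2]

lemma abs_mul_integral_sub_le {μ : Measure ℝ} {c C : ℝ} (hc : 0 ≤ c) {f g b : ℝ → ℝ}
    (hf : Integrable f μ) (hg : Integrable g μ) (hb : Integrable b μ)
    (h : ∀ t, |f t - g t| ≤ C * b t) :
    |c * ∫ t, f t ∂μ - c * ∫ t, g t ∂μ| ≤ C * (c * ∫ t, b t ∂μ) := by
  rw [← mul_sub, ← integral_sub hf hg, abs_mul, abs_of_nonneg hc]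
  have h1 : |∫ t, (f t - g t) ∂μ| ≤ ∫ t, C * b t ∂μ :=
    norm_integral_le_of_norm_le (f := fun t => f t - g t) (hb.const_mul C) (ae_of_all _ h)
  rw [integral_const_mul] at h1
  calc c * |∫ t, (f t - g t) ∂μ| ≤ c * (C * ∫ t, b t ∂μ) := mul_le_mul_of_nonneg_left h1 hc
    _ = _ := by ring

/-- The ratio `(1 - exp (-u)) / u`, extended continuously to `u = 0`. -/
noncomputable def oneSubExpNegSlope (u : ℝ) : ℝ := dslope (fun u : ℝ => 1 - Real.exp (-u)) 0 u

lemma mul_oneSubExpNegSlope (u : ℝ) : u * oneSubExpNegSlope u = 1 - Real.exp (-u) := by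
  have := sub_smul_dslope (fun u : ℝ => 1 - Real.exp (-u)) 0 u
  simpa [oneSubExpNegSlope] using this

lemma oneSubExpNegSlope_ne_zero (u : ℝ) : oneSubExpNegSlope u ≠ 0 := by
  rcases eq_or_ne u 0 with rfl | hu
  · have : HasDerivAt (fun u : ℝ => 1 - Real.exp (-u)) 1 0 := by
      simpa using ((hasDerivAt_id (0 : ℝ)).neg.exp).const_sub 1
    simp [oneSubExpNegSlope, this.deriv]
  · intro h
    have h1 := mul_oneSubExpNegSlope u
    rw [h, mul_zero] at h1
    have h2 : Real.exp (-u) = 1 := by linarith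
    rw [Real.exp_eq_one_iff] at h2
    exact hu (by linarith)

lemma continuous_oneSubExpNegSlope : Continuous oneSubExpNegSlope := by
  have h : Differentiable ℝ (fun u : ℝ => 1 - Real.exp (-u)) := by fun_prop
  rw [← continuousOn_univ]
  exact (continuousOn_dslope (Filter.univ_mem)).2 ⟨h.continuous.continuousOn, h 0⟩

section Laplace

variable {ν : ℕ → Measure ℝ} [∀ n, IsProbabilityMeasure (ν n)] {c : ℕ → ℝ} {Ψ : ℝ → ℝ}

lemma one_sub_exp_neg_mem_Icc {u : ℝ} (hu : 0 ≤ u) : 1 - Real.exp (-u) ∈ Set.Icc (0 : ℝ) 1 := by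
  have h1 : Real.exp (-u) ≤ 1 := Real.exp_le_one_iff.2 (by linarith)
  exact ⟨by linarith, by linarith [Real.exp_pos (-u)]⟩

lemma integrable_one_sub_exp_neg_mul_sq (μ : Measure ℝ) [IsFiniteMeasure μ] {a : ℝ} (ha : 0 ≤ a) :
    Integrable (fun t => 1 - Real.exp (-(a * t ^ 2))) μ := by
  refine integrable_of_continuous_of_abs_le (by fun_prop) 1 fun t => ?_
  have := one_sub_exp_neg_mem_Icc (u := a * t ^ 2) (by positivity)
  rw [abs_of_nonneg this.1]
  exact this.2

lemma integrable_comp_exp_neg_sq_mul (μ : Measure ℝ) [IsFiniteMeasure μ] {g : ℝ → ℝ}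
    (hg : ContinuousOn g (Set.Icc 0 1)) :
    Integrable (fun t => g (Real.exp (-t ^ 2)) * (1 - Real.exp (-t ^ 2))) μ := by
  have hmem : ∀ t : ℝ, Real.exp (-t ^ 2) ∈ Set.Icc (0 : ℝ) 1 := fun t =>
    ⟨(Real.exp_pos _).le, Real.exp_le_one_iff.2 (by nlinarith [sq_nonneg t])⟩
  obtain ⟨C, hC⟩ := isCompact_Icc.exists_bound_of_continuousOn hg
  have hcont : Continuous fun t : ℝ => g (Real.exp (-t ^ 2)) :=
    hg.comp_continuous (by fun_prop) hmem
  refine integrable_of_continuous_of_abs_le (hcont.mul (by fun_prop)) C fun t => ?_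
  have h1 := hC _ (hmem t)
  rw [Real.norm_eq_abs] at h1
  rw [abs_mul, abs_of_nonneg (by linarith [(hmem t).2] : (0 : ℝ) ≤ 1 - Real.exp (-t ^ 2))]
  nlinarith [(hmem t).1, abs_nonneg (g (Real.exp (-t ^ 2)))]

lemma exists_tendsto_integral_polynomial
    (hΨ : ∀ a > 0, Tendsto (fun n => c n * ∫ t, (1 - Real.exp (-(a * t ^ 2))) ∂(ν n)) atTop
      (𝓝 (Ψ a))) (p : Polynomial ℝ) :
    ∃ l, Tendsto (fun n => c n *
      ∫ t, p.eval (Real.exp (-t ^ 2)) * (1 - Real.exp (-t ^ 2)) ∂(ν n)) atTop (𝓝 l) := by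
  have hexp : ∀ (p : Polynomial ℝ) n, Integrable
      (fun t => p.eval (Real.exp (-t ^ 2)) * (1 - Real.exp (-t ^ 2))) (ν n) := fun p n =>
    integrable_comp_exp_neg_sq_mul _ p.continuous.continuousOn
  induction p using Polynomial.induction_on' with
  | add p q hp hq =>
    obtain ⟨l, hl⟩ := hp
    obtain ⟨m, hm⟩ := hq
    refine ⟨l + m, (hl.add hm).congr fun n => ?_⟩
    rw [← mul_add, ← integral_add (hexp p n) (hexp q n)]
    simp only [Polynomial.eval_add, add_mul]
  | monomial j r =>
    have hΨ' : ∀ j : ℕ, ∃ l, Tendsto (fun n => c n *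
        ∫ t, (1 - Real.exp (-((j : ℝ) * t ^ 2))) ∂(ν n)) atTop (𝓝 l) := by
      intro j
      rcases Nat.eq_zero_or_pos j with rfl | hj
      · exact ⟨0, by simp⟩
      · exact ⟨_, hΨ j (by exact_mod_cast hj)⟩
    obtain ⟨l, hl⟩ := hΨ' j
    obtain ⟨m, hm⟩ := hΨ' (j + 1)
    refine ⟨r * (m - l), ((hm.sub hl).const_mul r).congr fun n => ?_⟩
    rw [← mul_sub, ← integral_sub (integrable_one_sub_exp_neg_mul_sq _ (by positivity))
      (integrable_one_sub_exp_neg_mul_sq _ (by positivity)), mul_left_comm, ← integral_const_mul]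
    congr 2 with t
    have h1 : Real.exp (-((j : ℝ) * t ^ 2)) = Real.exp (-t ^ 2) ^ j := by
      rw [← Real.exp_nat_mul]; ring_nf
    have h2 : Real.exp (-(((j + 1 : ℕ) : ℝ) * t ^ 2)) = Real.exp (-t ^ 2) ^ (j + 1) := by
      rw [← Real.exp_nat_mul]; ring_nf
    rw [h1, h2, Polynomial.eval_monomial]
    ring

lemma exists_tendsto_integral_continuousOn (hc : ∀ n, 0 ≤ c n)
    (hΨ : ∀ a > 0, Tendsto (fun n => c n * ∫ t, (1 - Real.exp (-(a * t ^ 2))) ∂(ν n)) atTop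
      (𝓝 (Ψ a))) {g : ℝ → ℝ} (hg : ContinuousOn g (Set.Icc 0 1)) :
    ∃ l, Tendsto (fun n => c n *
      ∫ t, g (Real.exp (-t ^ 2)) * (1 - Real.exp (-t ^ 2)) ∂(ν n)) atTop (𝓝 l) := by
  have h1 := hΨ 1 one_pos
  simp only [one_mul] at h1
  have hK : ∀ᶠ n in atTop, c n * ∫ t, (1 - Real.exp (-t ^ 2)) ∂(ν n) ≤ |Ψ 1| + 1 :=
    h1.eventually_le_const (by linarith [le_abs_self (Ψ 1)])
  refine exists_tendsto_of_forall_approx fun ε hε => ?_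
  have hK0 : 0 < |Ψ 1| + 1 := by positivity
  obtain ⟨p, hp⟩ := exists_polynomial_near_of_continuousOn 0 1 g hg (ε / (|Ψ 1| + 1))
    (by positivity)
  refine ⟨_, exists_tendsto_integral_polynomial hΨ p, ?_⟩
  filter_upwards [hK] with n hn
  refine (abs_mul_integral_sub_le (hc n) (C := ε / (|Ψ 1| + 1))
    (b := fun t => 1 - Real.exp (-t ^ 2)) (integrable_comp_exp_neg_sq_mul _ hg)
    (integrable_comp_exp_neg_sq_mul _ p.continuous.continuousOn)
    (by simpa using integrable_one_sub_exp_neg_mul_sq (ν n) zero_le_one) fun t => ?_).trans ?_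
  · have hx := one_sub_exp_neg_mem_Icc (sq_nonneg t)
    rw [← sub_mul, abs_mul, abs_of_nonneg hx.1, abs_sub_comm]
    refine mul_le_mul_of_nonneg_right (hp _ ⟨(Real.exp_pos _).le, ?_⟩).le hx.1
    linarith [hx.1]
  · calc ε / (|Ψ 1| + 1) * (c n * ∫ t, (1 - Real.exp (-t ^ 2)) ∂(ν n))
        ≤ ε / (|Ψ 1| + 1) * (|Ψ 1| + 1) := mul_le_mul_of_nonneg_left hn (by positivity)
      _ = ε := by field_simp

lemma continuousOn_comp_neg_log_mul_rpow {h : ℝ → ℝ} (hh : Continuous h) {C : ℝ}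
    (hC : ∀ u > 0, |h u| ≤ C) {δ : ℝ} (hδ : 0 < δ) :
    ContinuousOn (fun x => h (-Real.log x) * x ^ δ) (Set.Icc 0 1) := by
  intro x hx
  rcases eq_or_lt_of_le hx.1 with rfl | hx0
  · have hz : Tendsto (fun x : ℝ => C * x ^ δ) (𝓝[Set.Icc 0 1] 0) (𝓝 0) := by
      have h1 : ContinuousAt (fun x : ℝ => C * x ^ δ) 0 :=
        (Real.continuousAt_rpow_const 0 δ (Or.inr hδ.le)).const_mul C
      have h2 := h1.continuousWithinAt (s := Set.Icc 0 1)
      simpa [ContinuousWithinAt, Real.zero_rpow hδ.ne'] using h2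
    rw [ContinuousWithinAt, Real.zero_rpow hδ.ne', mul_zero]
    refine squeeze_zero_norm' ?_ hz
    have hlt : ∀ᶠ x : ℝ in 𝓝[Set.Icc 0 1] 0, x < 1 :=
      mem_nhdsWithin_of_mem_nhds (Iio_mem_nhds one_pos)
    filter_upwards [self_mem_nhdsWithin, hlt] with x hx hx1
    rcases eq_or_lt_of_le hx.1 with rfl | hx0
    · simp [Real.zero_rpow hδ.ne']
    · rw [norm_mul, Real.norm_eq_abs, Real.norm_eq_abs, abs_of_nonneg (Real.rpow_nonneg hx.1 δ)]
      exact mul_le_mul_of_nonneg_right (hC _ (by linarith [Real.log_neg hx0 hx1]))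
        (Real.rpow_nonneg hx.1 δ)
  · apply ContinuousAt.continuousWithinAt
    exact (hh.continuousAt.comp (Real.continuousAt_log hx0.ne').neg).mul
      (Real.continuousAt_rpow_const x δ (Or.inr hδ.le))

/-- If the Laplace exponents `c n * ∫ (1 - exp (-a t²)) dν n` converge to a function vanishing at
`0⁺`, then so do the integrals of all `f` of the form `f t = t² * w (t²)` with `w` continuous and
`f` dominated by `1 - exp (-t²)`. -/
lemma exists_tendsto_integral_of_laplace (hc : ∀ n, 0 ≤ c n)
    (hΨ : ∀ a > 0, Tendsto (fun n => c n * ∫ t, (1 - Real.exp (-(a * t ^ 2))) ∂(ν n)) atTop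
      (𝓝 (Ψ a))) (hΨ0 : Tendsto Ψ (𝓝[>] 0) (𝓝 0)) {w : ℝ → ℝ} (hw : Continuous w) {C : ℝ}
    (hC : ∀ u ≥ 0, |u * w u| ≤ C * (1 - Real.exp (-u))) :
    ∃ l, Tendsto (fun n => c n * ∫ t, t ^ 2 * w (t ^ 2) ∂(ν n)) atTop (𝓝 l) := by
  have hCpos : 0 ≤ C := by
    have h1 := (abs_nonneg _).trans (hC 1 zero_le_one)
    have h2 : 0 < 1 - Real.exp (-1) := by
      have : Real.exp (-1) < 1 := Real.exp_lt_one_iff.2 (by norm_num)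
      linarith
    exact nonneg_of_mul_nonneg_left h1 h2
  refine exists_tendsto_of_forall_approx fun ε hε => ?_
  obtain ⟨δ, hδΨ, hδ⟩ : ∃ δ, C * Ψ δ < ε ∧ 0 < δ := by
    have h1 := hΨ0.const_mul C
    rw [mul_zero] at h1
    exact ((h1.eventually_lt_const hε).and self_mem_nhdsWithin).exists
  have hh : Continuous fun u => w u / oneSubExpNegSlope u :=
    hw.div continuous_oneSubExpNegSlope oneSubExpNegSlope_ne_zero
  have hhC : ∀ u > 0, |w u / oneSubExpNegSlope u| ≤ C := by
    intro u hu
    have h1 := hC u hu.le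
    rw [← mul_oneSubExpNegSlope, ← mul_div_mul_left (w u) _ hu.ne', abs_div] at *
    have h2 : 0 < u * oneSubExpNegSlope u := by
      rw [mul_oneSubExpNegSlope]
      linarith [Real.exp_lt_one_iff.2 (neg_lt_zero.2 hu)]
    rw [abs_of_pos h2, div_le_iff₀ h2]
    exact h1
  have hg := continuousOn_comp_neg_log_mul_rpow hh hhC hδ
  have heq : ∀ t : ℝ, (w (-Real.log (Real.exp (-t ^ 2))) /
      oneSubExpNegSlope (-Real.log (Real.exp (-t ^ 2))) * Real.exp (-t ^ 2) ^ δ) *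
        (1 - Real.exp (-t ^ 2)) = t ^ 2 * w (t ^ 2) * Real.exp (-(δ * t ^ 2)) := by
    intro t
    rw [Real.log_exp, neg_neg, ← Real.exp_mul, ← mul_oneSubExpNegSlope]
    have := oneSubExpNegSlope_ne_zero (t ^ 2)
    field_simp
  refine ⟨_, exists_tendsto_integral_continuousOn hc hΨ hg, ?_⟩
  filter_upwards [((hΨ δ hδ).const_mul C).eventually_lt_const hδΨ] with n hn
  refine (abs_mul_integral_sub_le (hc n) (C := C) (b := fun t => 1 - Real.exp (-(δ * t ^ 2))) ?_
    (integrable_comp_exp_neg_sq_mul _ hg) (integrable_one_sub_exp_neg_mul_sq _ hδ.le)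
    fun t => ?_).trans hn.le
  · refine integrable_of_continuous_of_abs_le (by fun_prop) C fun t => ?_
    refine (hC _ (sq_nonneg t)).trans ?_
    exact mul_le_of_le_one_right hCpos (one_sub_exp_neg_mem_Icc (sq_nonneg t)).2
  · rw [heq, ← mul_one_sub, abs_mul]
    have h1 := one_sub_exp_neg_mem_Icc (u := δ * t ^ 2) (by positivity)
    rw [abs_of_nonneg h1.1]
    refine mul_le_mul_of_nonneg_right ((hC _ (sq_nonneg t)).trans ?_) h1.1
    exact mul_le_of_le_one_right hCpos (one_sub_exp_neg_mem_Icc (sq_nonneg t)).2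

end Laplace

/-! ### Laplace exponents determine the limits of both convolution powers -/

section Limits

variable {ν : ℕ → Measure ℝ} {k : ℕ → ℕ} {Ψ : ℝ → ℝ}

lemma exists_weakTendsto_convPow_of_norm_le {μ : ℕ → Measure ℝ} [∀ n, IsProbabilityMeasure (μ n)]
    (hk : Tendsto k atTop atTop)
    (hΨ : ∀ a > 0, Tendsto (fun n => (k n : ℝ) * ∫ t, (1 - Real.exp (-(a * t ^ 2))) ∂(ν n)) atTop
      (𝓝 (Ψ a))) (hΨ0 : Tendsto Ψ (𝓝[>] 0) (𝓝 0))
    (hlim : ∀ s, ∃ z, Tendsto (fun n => (k n : ℂ) * (charFun (μ n) s - 1)) atTop (𝓝 z))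
    {b : ℝ → ℝ} (hb : Continuous b) (hb0 : b 0 = 0) (hbpos : ∀ s ≠ 0, 0 < b s)
    (hbound : ∀ s ≠ 0, ∀ n,
      ‖charFun (μ n) s - 1‖ ≤ 4 * ∫ t, (1 - Real.exp (-(b s * t ^ 2))) ∂(ν n)) :
    ∃ μ' : Measure ℝ, IsProbabilityMeasure μ' ∧ WeakTendsto (fun n => convPow (μ n) (k n)) μ' := by
  choose z hz using hlim
  refine exists_weakTendsto_convPow hk ?_ hz
  have hz0 : z 0 = 0 := tendsto_nhds_unique (hz 0) (by simp)
  have hle : ∀ s ≠ 0, ‖z s‖ ≤ 4 * Ψ (b s) := fun s hs => by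
    refine le_of_tendsto_of_tendsto' (hz s).norm ((hΨ _ (hbpos s hs)).const_mul 4) fun n => ?_
    rw [norm_mul, Complex.norm_natCast]
    have := mul_le_mul_of_nonneg_left (hbound s hs n) (Nat.cast_nonneg (k n))
    linarith
  rw [← continuousWithinAt_compl_self, ContinuousWithinAt, hz0]
  have hbt : Tendsto b (𝓝[≠] 0) (𝓝[>] 0) := by
    refine tendsto_nhdsWithin_iff.2 ⟨?_, ?_⟩
    · have := hb.tendsto 0
      rw [hb0] at this
      exact this.mono_left nhdsWithin_le_nhds
    · filter_upwards [self_mem_nhdsWithin] with s hs using hbpos s hs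
  have hΨb := (hΨ0.comp hbt).const_mul 4
  rw [mul_zero] at hΨb
  refine squeeze_zero_norm' ?_ hΨb
  filter_upwards [self_mem_nhdsWithin] with s hs using hle s hs

variable [∀ n, IsProbabilityMeasure (ν n)]

lemma one_sub_cos_eq_mul_sinc_sq (x : ℝ) :
    1 - Real.cos x = x ^ 2 * (Real.sinc (x / 2) ^ 2 / 2) := by
  rw [one_sub_cos_eq_two_mul_sin_sq, sin_eq_mul_sinc]
  ring

lemma integral_one_sub_cos (μ : Measure ℝ) [IsProbabilityMeasure μ] (s : ℝ) :
    ∫ t, (1 - Real.cos (s * t)) ∂μ = 1 - ∫ t, Real.cos (s * t) ∂μ := by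
  rw [integral_sub (integrable_const 1) (integrable_cos_mul μ s)]
  simp

lemma exists_weakTendsto_convPow_of_laplace (hsym : ∀ n, (ν n).map (fun x => -x) = ν n)
    (hk : Tendsto k atTop atTop)
    (hΨ : ∀ a > 0, Tendsto (fun n => (k n : ℝ) * ∫ t, (1 - Real.exp (-(a * t ^ 2))) ∂(ν n)) atTop
      (𝓝 (Ψ a))) (hΨ0 : Tendsto Ψ (𝓝[>] 0) (𝓝 0)) :
    ∃ μ : Measure ℝ, IsProbabilityMeasure μ ∧ WeakTendsto (fun n => convPow (ν n) (k n)) μ := by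
  have hchar : ∀ n s, charFun (ν n) s - 1 = ((-∫ t, (1 - Real.cos (s * t)) ∂(ν n) : ℝ) : ℂ) := by
    intro n s
    rw [charFun_eq_integral_cos_of_symm (hsym n), integral_one_sub_cos]
    push_cast
    ring
  refine exists_weakTendsto_convPow_of_norm_le hk hΨ hΨ0 (fun s => ?_) (b := fun s => s ^ 2)
    (by fun_prop) (by simp) (fun s hs => by positivity) fun s hs n => ?_
  · have hw : Continuous fun u : ℝ => s ^ 2 * (Real.sinc (s * √u / 2) ^ 2 / 2) := by
      have := Real.continuous_sinc
      fun_prop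
    have heq : ∀ u ≥ 0, u * (s ^ 2 * (Real.sinc (s * √u / 2) ^ 2 / 2)) =
        1 - Real.cos (s * √u) := fun u hu => by
      rw [one_sub_cos_eq_mul_sinc_sq, mul_pow, Real.sq_sqrt hu]
      ring
    obtain ⟨l, hl⟩ := exists_tendsto_integral_of_laplace (fun n => Nat.cast_nonneg (k n)) hΨ hΨ0 hw
      (C := 4 * (2 * (1 + s ^ 2))) (fun u hu => by
        rw [heq u hu, abs_of_nonneg (by linarith [Real.cos_le_one (s * √u)])]
        have h1 := one_sub_cos_le_mul_one_sub_exp_neg_sq (s * √u)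
        rw [mul_pow, Real.sq_sqrt hu] at h1
        linarith [one_sub_exp_neg_mul_le (sq_nonneg s) hu])
    refine ⟨((-l : ℝ) : ℂ), ((Complex.continuous_ofReal.tendsto _).comp hl.neg).congr fun n => ?_⟩
    rw [hchar]
    have : ∀ t : ℝ, t ^ 2 * (s ^ 2 * (Real.sinc (s * √(t ^ 2) / 2) ^ 2 / 2)) =
        1 - Real.cos (s * t) := fun t => by
      rw [heq _ (sq_nonneg t), Real.sqrt_sq_eq_abs, ← Real.cos_abs (s * |t|), abs_mul, abs_abs,
        ← abs_mul, Real.cos_abs]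
    simp only [this, Function.comp_apply]
    push_cast
    ring
  · rw [hchar, Complex.norm_real, norm_neg, ← integral_const_mul]
    refine norm_integral_le_of_norm_le
      ((integrable_one_sub_exp_neg_mul_sq _ (sq_nonneg s)).const_mul 4) (ae_of_all _ fun t => ?_)
    rw [Real.norm_eq_abs, abs_of_nonneg (by linarith [Real.cos_le_one (s * t)]), ← mul_pow]
    exact one_sub_cos_le_mul_one_sub_exp_neg_sq _

lemma charFun_map_sq_sub_one (μ : Measure ℝ) [IsProbabilityMeasure μ] (r : ℝ) :
    charFun (μ.map (fun t => t ^ 2)) r - 1 =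
      ∫ t, (Complex.exp (((r * t ^ 2 : ℝ) : ℂ) * Complex.I) - 1) ∂μ := by
  have hi : Integrable (fun t : ℝ => Complex.exp (((r * t ^ 2 : ℝ) : ℂ) * Complex.I)) μ :=
    Integrable.of_bound (by fun_prop) 1
      (ae_of_all _ fun t => (Complex.norm_exp_ofReal_mul_I _).le)
  rw [charFun_apply_real, integral_map (by fun_prop) (by fun_prop),
    integral_sub hi (integrable_const 1)]
  simp

lemma exists_weakTendsto_convPow_map_sq_of_laplace (hk : Tendsto k atTop atTop)
    (hΨ : ∀ a > 0, Tendsto (fun n => (k n : ℝ) * ∫ t, (1 - Real.exp (-(a * t ^ 2))) ∂(ν n)) atTop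
      (𝓝 (Ψ a))) (hΨ0 : Tendsto Ψ (𝓝[>] 0) (𝓝 0)) :
    ∃ ρ : Measure ℝ, IsProbabilityMeasure ρ ∧
      WeakTendsto (fun n => convPow ((ν n).map (fun t => t ^ 2)) (k n)) ρ := by
  have : ∀ n, IsProbabilityMeasure ((ν n).map (fun t => t ^ 2)) := fun n =>
    Measure.isProbabilityMeasure_map (by fun_prop)
  have hbnd : ∀ r t : ℝ, ‖Complex.exp (((r * t ^ 2 : ℝ) : ℂ) * Complex.I) - 1‖ ≤
      4 * (1 - Real.exp (-(|r| * t ^ 2))) := fun r t => by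
    have := norm_cexp_mul_I_sub_one_le (r * t ^ 2)
    rwa [abs_mul, abs_of_nonneg (sq_nonneg t)] at this
  refine exists_weakTendsto_convPow_of_norm_le hk hΨ hΨ0 (fun r => ?_) (b := fun r => |r|)
    (by fun_prop) (by simp) (fun s hs => by positivity) fun r hr n => ?_
  · have hbnd' : ∀ u ≥ 0, ‖Complex.exp (((r * u : ℝ) : ℂ) * Complex.I) - 1‖ ≤
        4 * (2 * (1 + |r|)) * (1 - Real.exp (-u)) := fun u hu => by
      have h1 := hbnd r √u
      rw [Real.sq_sqrt hu] at h1
      linarith [one_sub_exp_neg_mul_le (abs_nonneg r) hu]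
    have hcos : ∀ u : ℝ, u * (u * (r ^ 2 * (Real.sinc (r * u / 2) ^ 2 / 2))) =
        1 - Real.cos (r * u) := fun u => by
      rw [one_sub_cos_eq_mul_sinc_sq]; ring
    have hsin : ∀ u : ℝ, u * (r * Real.sinc (r * u)) = Real.sin (r * u) := fun u => by
      rw [sin_eq_mul_sinc]; ring
    have hsinc := Real.continuous_sinc
    obtain ⟨l, hl⟩ := exists_tendsto_integral_of_laplace (fun n => Nat.cast_nonneg (k n)) hΨ hΨ0
      (w := fun u => u * (r ^ 2 * (Real.sinc (r * u / 2) ^ 2 / 2))) (by fun_prop)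
      (C := 4 * (2 * (1 + |r|))) (fun u hu => by
        refine le_trans ?_ (hbnd' u hu)
        have := Complex.abs_re_le_norm (Complex.exp (((r * u : ℝ) : ℂ) * Complex.I) - 1)
        rwa [Complex.sub_re, Complex.exp_ofReal_mul_I_re, Complex.one_re, abs_sub_comm,
          ← hcos u] at this)
    obtain ⟨m, hm⟩ := exists_tendsto_integral_of_laplace (fun n => Nat.cast_nonneg (k n)) hΨ hΨ0
      (w := fun u => r * Real.sinc (r * u)) (by fun_prop)
      (C := 4 * (2 * (1 + |r|))) (fun u hu => by
        refine le_trans ?_ (hbnd' u hu)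
        have := Complex.abs_im_le_norm (Complex.exp (((r * u : ℝ) : ℂ) * Complex.I) - 1)
        rwa [Complex.sub_im, Complex.exp_ofReal_mul_I_im, Complex.one_im, sub_zero,
          ← hsin u] at this)
    simp only [hcos] at hl
    simp only [hsin] at hm
    refine ⟨((-l : ℝ) : ℂ) + (m : ℂ) * Complex.I,
      (((Complex.continuous_ofReal.tendsto _).comp hl.neg).add
        (((Complex.continuous_ofReal.tendsto _).comp hm).mul_const Complex.I)).congr fun n => ?_⟩
    have hic : Integrable (fun t : ℝ => 1 - Real.cos (r * t ^ 2)) (ν n) :=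
      integrable_of_continuous_of_abs_le (by fun_prop) 2 fun t => by
        rw [abs_le]; constructor <;> linarith [Real.cos_le_one (r * t ^ 2),
          Real.neg_one_le_cos (r * t ^ 2)]
    have his : Integrable (fun t : ℝ => Real.sin (r * t ^ 2)) (ν n) :=
      integrable_of_continuous_of_abs_le (by fun_prop) 1 fun t => Real.abs_sin_le_one _
    have hsplit : ∀ t : ℝ, Complex.exp (((r * t ^ 2 : ℝ) : ℂ) * Complex.I) - 1 =
        ((Real.sin (r * t ^ 2) : ℝ) : ℂ) * Complex.I - ((1 - Real.cos (r * t ^ 2) : ℝ) : ℂ) := by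
      intro t
      rw [Complex.exp_mul_I, ← Complex.ofReal_cos, ← Complex.ofReal_sin]
      push_cast
      ring
    rw [charFun_map_sq_sub_one]
    simp_rw [hsplit]
    have hic' : Integrable (fun t : ℝ => ((1 - Real.cos (r * t ^ 2) : ℝ) : ℂ)) (ν n) := hic.ofReal
    have his' : Integrable (fun t : ℝ => ((Real.sin (r * t ^ 2) : ℝ) : ℂ)) (ν n) := his.ofReal
    rw [integral_sub (his'.mul_const Complex.I) hic', integral_mul_const,
      integral_complex_ofReal, integral_complex_ofReal]
    simp only [Function.comp_apply]
    push_cast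
    ring
  · rw [charFun_map_sq_sub_one, ← integral_const_mul]
    exact norm_integral_le_of_norm_le
      ((integrable_one_sub_exp_neg_mul_sq _ (abs_nonneg r)).const_mul 4) (ae_of_all _ (hbnd r))

end Limits

/-! ### Convergence of the Laplace exponents -/

section LaplaceExponent

variable {ν : ℕ → Measure ℝ} [∀ n, IsProbabilityMeasure (ν n)] {k : ℕ → ℕ}

lemma exists_laplace_of_weakTendsto_map_sq (hk : Tendsto k atTop atTop) {ρ : Measure ℝ}
    [IsProbabilityMeasure ρ]
    (h : WeakTendsto (fun n => convPow ((ν n).map (fun t => t ^ 2)) (k n)) ρ) :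
    ∃ Ψ : ℝ → ℝ, (∀ a > 0, Tendsto
      (fun n => (k n : ℝ) * ∫ t, (1 - Real.exp (-(a * t ^ 2))) ∂(ν n)) atTop (𝓝 (Ψ a))) ∧
      Tendsto Ψ (𝓝[>] 0) (𝓝 0) := by
  have hp : ∀ n, IsProbabilityMeasure ((ν n).map (fun t => t ^ 2)) := fun n =>
    Measure.isProbabilityMeasure_map (by fun_prop)
  have hbd : ∀ a > 0, ∀ x : ℝ, |Real.exp (-(a * max x 0))| ≤ 1 := fun a ha x => by
    rw [abs_of_pos (Real.exp_pos _)]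
    exact Real.exp_le_one_iff.2 (neg_nonpos.2 (mul_nonneg ha.le (le_max_right _ _)))
  refine ⟨fun a => -Real.log (∫ x, Real.exp (-(a * max x 0)) ∂ρ), fun a ha => ?_, ?_⟩
  · have hexp : ∀ n, Integrable (fun t => Real.exp (-(a * t ^ 2))) (ν n) := fun n =>
      integrable_of_continuous_of_abs_le (by fun_prop) 1 fun t => by
        have := hbd a ha (t ^ 2)
        rwa [max_eq_left (sq_nonneg t)] at this
    have hpow : ∀ n, ∫ x, Real.exp (-(a * max x 0))
        ∂(convPow ((ν n).map (fun t => t ^ 2)) (k n)) =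
          (∫ t, Real.exp (-(a * t ^ 2)) ∂(ν n)) ^ k n := by
      intro n
      have h1 : ∀ᵐ x ∂((ν n).map (fun t => t ^ 2)), 0 ≤ x := by
        rw [ae_map_iff (by fun_prop) measurableSet_Ici]
        exact ae_of_all _ fun t => sq_nonneg t
      have h2 : ∫ t, Real.exp (-(a * t ^ 2)) ∂(ν n) =
          ∫ x, Real.exp (-(a * x)) ∂((ν n).map (fun t => t ^ 2)) := by
        rw [integral_map (by fun_prop) (by fun_prop)]
      rw [h2, ← integral_convPow_of_map_add _ (by fun_prop) (by simp)
        (fun x y => by rw [← Real.exp_add]; ring_nf)]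
      refine integral_congr_ae ?_
      filter_upwards [ae_nonneg_convPow h1 (k n)] with x hx
      rw [max_eq_left hx]
    have hlim := h.tendsto_integral (f := fun x => Real.exp (-(a * max x 0))) (by fun_prop) 1
      (hbd a ha)
    simp_rw [hpow] at hlim
    have hpos : 0 < ∫ x, Real.exp (-(a * max x 0)) ∂ρ :=
      integral_exp_pos (integrable_of_continuous_of_abs_le (by fun_prop) 1 (hbd a ha))
    refine (tendsto_natCast_mul_one_sub_of_tendsto_pow hk hpos
      (Eventually.of_forall fun n => integral_exp_pos (hexp n)) hlim).congr fun n => ?_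
    rw [integral_sub (integrable_const 1) (hexp n)]
    simp
  · have hL : Tendsto (fun a => ∫ x, Real.exp (-(a * max x 0)) ∂ρ) (𝓝[>] 0)
        (𝓝 (∫ _, (1 : ℝ) ∂ρ)) := by
      refine tendsto_integral_filter_of_dominated_convergence (fun _ => 1)
        (Eventually.of_forall fun a => by fun_prop) ?_ (integrable_const 1)
        (ae_of_all _ fun x => ?_)
      · filter_upwards [self_mem_nhdsWithin] with a ha using ae_of_all _ (hbd a ha)
      · have : Continuous fun a : ℝ => Real.exp (-(a * max x 0)) := by fun_prop
        simpa using (this.tendsto 0).mono_left nhdsWithin_le_nhds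
    have := ((Real.continuousAt_log (by simp)).tendsto.comp hL).neg
    simpa [Function.comp_def] using this

lemma integral_cos_convPow (μ : Measure ℝ) [IsProbabilityMeasure μ]
    (hsym : μ.map (fun x => -x) = μ) (k : ℕ) (s : ℝ) :
    ∫ x, Real.cos (s * x) ∂(convPow μ k) = (∫ t, Real.cos (s * t) ∂μ) ^ k := by
  rw [← re_charFun, charFun_convPow, charFun_eq_integral_cos_of_symm hsym,
    ← Complex.ofReal_pow, Complex.ofReal_re]

lemma tendsto_integral_cos_pow (hsym : ∀ n, (ν n).map (fun x => -x) = ν n) {μ : Measure ℝ}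
    (h : WeakTendsto (fun n => convPow (ν n) (k n)) μ) (s : ℝ) :
    Tendsto (fun n => (∫ t, Real.cos (s * t) ∂(ν n)) ^ k n) atTop
      (𝓝 (∫ x, Real.cos (s * x) ∂μ)) := by
  refine (h.tendsto_integral (f := fun x => Real.cos (s * x)) (by fun_prop) 1
    fun x => Real.abs_cos_le_one _).congr fun n => ?_
  exact integral_cos_convPow _ (hsym n) _ s

lemma exists_eventually_half_le_integral_cos {μs : ℕ → Measure ℝ}
    [∀ n, IsProbabilityMeasure (μs n)] {μ : Measure ℝ} [IsProbabilityMeasure μ]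
    (h : WeakTendsto μs μ) :
    ∃ η > 0, ∀ᶠ n in atTop, ∀ s, |s| ≤ η → 1 / 2 ≤ ∫ x, Real.cos (s * x) ∂(μs n) := by
  have hbd : ∀ a x : ℝ, |1 - Real.exp (-(a * x) ^ 2)| ≤ 1 := fun a x => by
    have := one_sub_exp_neg_mem_Icc (sq_nonneg (a * x))
    rw [abs_of_nonneg this.1]
    exact this.2
  have hlim : Tendsto (fun a => ∫ x, (1 - Real.exp (-(a * x) ^ 2)) ∂μ) (𝓝[>] 0)
      (𝓝 (∫ _, (0 : ℝ) ∂μ)) := by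
    refine tendsto_integral_filter_of_dominated_convergence (fun _ => 1)
      (Eventually.of_forall fun a => by fun_prop) (Eventually.of_forall fun a =>
        ae_of_all _ (hbd a)) (integrable_const 1) (ae_of_all _ fun x => ?_)
    have : Continuous fun a : ℝ => 1 - Real.exp (-(a * x) ^ 2) := by fun_prop
    simpa using (this.tendsto 0).mono_left nhdsWithin_le_nhds
  rw [integral_zero] at hlim
  obtain ⟨η, hη, hη0⟩ := ((hlim.eventually_lt_const (by norm_num : (0 : ℝ) < 1 / 8)).and
    self_mem_nhdsWithin).exists
  refine ⟨η, hη0, ?_⟩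
  filter_upwards [(h.tendsto_integral (f := fun x => 1 - Real.exp (-(η * x) ^ 2)) (by fun_prop) 1
    (hbd η)).eventually_lt_const hη] with n hn s hs
  have h1 : ∫ x, (1 - Real.cos (s * x)) ∂(μs n) ≤
      ∫ x, 4 * (1 - Real.exp (-(η * x) ^ 2)) ∂(μs n) := by
    refine integral_mono ((integrable_const 1).sub (integrable_cos_mul _ s))
      ((integrable_of_continuous_of_abs_le (by fun_prop) 1 (hbd η)).const_mul 4) fun x => ?_
    refine (one_sub_cos_le_mul_one_sub_exp_neg_sq (s * x)).trans ?_
    have : (s * x) ^ 2 ≤ (η * x) ^ 2 := by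
      rw [mul_pow, mul_pow]
      exact mul_le_mul_of_nonneg_right (sq_le_sq' (abs_le.1 hs).1 (abs_le.1 hs).2) (sq_nonneg x)
    have h2 : Real.exp (-(η * x) ^ 2) ≤ Real.exp (-(s * x) ^ 2) := Real.exp_le_exp.2 (by linarith)
    show _ ≤ 4 * (1 - Real.exp (-(η * x) ^ 2))
    linarith
  rw [integral_const_mul, integral_one_sub_cos] at h1
  linarith

lemma abs_integral_cos_le_one (μ : Measure ℝ) [IsProbabilityMeasure μ] (s : ℝ) :
    |∫ t, Real.cos (s * t) ∂μ| ≤ 1 := by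
  have := norm_integral_le_of_norm_le_const (μ := μ) (f := fun t => Real.cos (s * t)) (C := 1)
    (ae_of_all _ fun t => Real.abs_cos_le_one _)
  simpa using this

/-- A doubling inequality for real parts of characteristic functions. -/
lemma one_sub_integral_cos_two_mul_le (μ : Measure ℝ) [IsProbabilityMeasure μ] (s : ℝ) :
    1 - ∫ t, Real.cos (2 * s * t) ∂μ ≤ 2 * (1 - (∫ t, Real.cos (s * t) ∂μ) ^ 2) := by
  have hi : Integrable (fun t => Real.cos (s * t) ^ 2) μ :=
    integrable_of_continuous_of_abs_le (by fun_prop) 1 fun t => by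
      rw [abs_pow]; exact pow_le_one₀ (abs_nonneg _) (Real.abs_cos_le_one _)
  have h1 : ∫ t, Real.cos (2 * s * t) ∂μ = 2 * ∫ t, Real.cos (s * t) ^ 2 ∂μ - 1 := by
    rw [← integral_const_mul]
    have : ∀ t, Real.cos (2 * s * t) = 2 * Real.cos (s * t) ^ 2 - 1 := fun t => by
      rw [mul_assoc, Real.cos_two_mul]
    simp_rw [this]
    rw [integral_sub (hi.const_mul 2) (integrable_const 1)]
    simp
  have h2 : 0 ≤ ∫ t, (Real.cos (s * t) - ∫ u, Real.cos (s * u) ∂μ) ^ 2 ∂μ :=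
    integral_nonneg fun t => sq_nonneg _
  set m := ∫ u, Real.cos (s * u) ∂μ with hm
  have h3 : ∫ t, (Real.cos (s * t) - m) ^ 2 ∂μ = ∫ t, Real.cos (s * t) ^ 2 ∂μ - m ^ 2 := by
    have : ∀ t, (Real.cos (s * t) - m) ^ 2 =
        Real.cos (s * t) ^ 2 - 2 * m * Real.cos (s * t) + m ^ 2 := fun t => by ring
    simp_rw [this]
    have hic := (integrable_cos_mul μ s).const_mul (2 * m)
    have hsub : Integrable (fun t => Real.cos (s * t) ^ 2 - 2 * m * Real.cos (s * t)) μ :=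
      hi.sub hic
    rw [integral_add hsub (integrable_const (m ^ 2)), integral_sub hi hic,
      integral_const_mul, ← hm]
    simp
    ring
  linarith

lemma natCast_mul_one_sub_le_of_le_pow {x q : ℝ} {k : ℕ} (hx : 0 < x) (hq : 0 < q)
    (h : q ≤ x ^ k) : (k : ℝ) * (1 - x) ≤ -Real.log q := by
  have h1 := Real.log_le_log hq h
  rw [Real.log_pow] at h1
  have h2 := Real.log_le_sub_one_of_pos hx
  nlinarith [(Nat.cast_nonneg k : (0 : ℝ) ≤ k)]

lemma one_sub_integral_cos_natCast_mul_le (μ : Measure ℝ) [IsProbabilityMeasure μ] (N : ℕ)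
    (s : ℝ) : 1 - ∫ t, Real.cos (N * s * t) ∂μ ≤ N ^ 2 * (1 - ∫ t, Real.cos (s * t) ∂μ) := by
  rw [← integral_one_sub_cos, ← integral_one_sub_cos, ← integral_const_mul]
  refine integral_mono ((integrable_const 1).sub (integrable_cos_mul _ _))
    (((integrable_const 1).sub (integrable_cos_mul _ _)).const_mul _) fun t => ?_
  simpa [mul_assoc] using one_sub_cos_natCast_mul_le N (s * t)

lemma exists_eventually_one_sub_integral_cos_le (hsym : ∀ n, (ν n).map (fun x => -x) = ν n)
    (hk : Tendsto k atTop atTop) {μ : Measure ℝ} [IsProbabilityMeasure μ]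
    (h : WeakTendsto (fun n => convPow (ν n) (k n)) μ) :
    ∃ K η : ℝ, 0 ≤ K ∧ 0 < η ∧ ∀ᶠ n in atTop, ∀ s,
      (k n : ℝ) * (1 - ∫ t, Real.cos (s * t) ∂(ν n)) ≤ (|s| / η + 1) ^ 2 * K := by
  obtain ⟨η, hη, hev⟩ := exists_eventually_half_le_integral_cos h
  have hK : 0 ≤ 2 * -Real.log (1 / 4) := by
    have := Real.log_nonpos (by norm_num : (0 : ℝ) ≤ 1 / 4) (by norm_num)
    linarith
  refine ⟨2 * -Real.log (1 / 4), η, hK, hη, ?_⟩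
  filter_upwards [hev, hk.eventually_ge_atTop 1] with n hn hkn s
  have hsmall : ∀ s, |s| ≤ η →
      (k n : ℝ) * (1 - ∫ t, Real.cos (s * t) ∂(ν n)) ≤ 2 * -Real.log (1 / 4) := by
    intro s hs
    have h1 := hn (s / 2) (by rw [abs_div, abs_two]; linarith [abs_nonneg s])
    rw [integral_cos_convPow _ (hsym n)] at h1
    have h2 := one_sub_integral_cos_two_mul_le (ν n) (s / 2)
    rw [mul_div_cancel₀ s two_ne_zero] at h2
    set m := ∫ t, Real.cos (s / 2 * t) ∂(ν n)
    have hm : m ≠ 0 := by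
      intro h0
      rw [h0, zero_pow (by omega)] at h1
      norm_num at h1
    have h3 : (1 / 4 : ℝ) ≤ (m ^ 2) ^ k n := by
      rw [← pow_mul, mul_comm, pow_mul]
      nlinarith
    have h4 := natCast_mul_one_sub_le_of_le_pow (by positivity) (by norm_num) h3
    have h5 := mul_le_mul_of_nonneg_left h2 (Nat.cast_nonneg (α := ℝ) (k n))
    linarith
  set N : ℕ := ⌈|s| / η⌉₊ with hN
  rcases eq_or_ne s 0 with rfl | hs
  · simp only [zero_mul, Real.cos_zero, integral_const, probReal_univ, one_smul, sub_self,
      mul_zero]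
    positivity
  have hs' : 0 < |s| / η := by positivity
  have hNpos : (0 : ℝ) < N := by exact_mod_cast Nat.ceil_pos.2 hs'
  have hle : |s| / η ≤ N := Nat.le_ceil _
  have hlt : (N : ℝ) < |s| / η + 1 := Nat.ceil_lt_add_one hs'.le
  have h1 := one_sub_integral_cos_natCast_mul_le (ν n) N (s / N)
  rw [mul_div_cancel₀ s hNpos.ne'] at h1
  have h2 := hsmall (s / N) (by
    rw [abs_div, abs_of_pos hNpos, div_le_iff₀ hNpos]
    rw [div_le_iff₀ hη] at hle
    linarith)
  calc (k n : ℝ) * (1 - ∫ t, Real.cos (s * t) ∂(ν n))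
      ≤ k n * (N ^ 2 * (1 - ∫ t, Real.cos (s / N * t) ∂(ν n))) := by gcongr
    _ = N ^ 2 * (k n * (1 - ∫ t, Real.cos (s / N * t) ∂(ν n))) := by ring
    _ ≤ N ^ 2 * (2 * -Real.log (1 / 4)) := by gcongr
    _ ≤ _ := by gcongr

lemma pos_and_tendsto_of_eventually_le (hk : Tendsto k atTop atTop) {x : ℕ → ℝ} {B l : ℝ}
    (hB : ∀ᶠ n in atTop, (k n : ℝ) * (1 - x n) ≤ B)
    (h : Tendsto (fun n => x n ^ k n) atTop (𝓝 l)) :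
    0 < l ∧ Tendsto (fun n => (k n : ℝ) * (1 - x n)) atTop (𝓝 (-Real.log l)) := by
  have h0 : Tendsto (fun n => 1 + -B / (k n : ℝ)) atTop (𝓝 1) := by
    have := ((tendsto_inv_atTop_nhds_zero_nat (𝕜 := ℝ)).comp hk).const_mul (-B)
    simpa [div_eq_mul_inv] using this.const_add 1
  have hpos : ∀ᶠ n in atTop, 0 < 1 + -B / (k n : ℝ) := h0.eventually_const_lt one_pos
  have hle : ∀ᶠ n in atTop, 1 + -B / (k n : ℝ) ≤ x n := by
    filter_upwards [hB, hk.eventually_ge_atTop 1] with n hn hkn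
    have hkn' : (0 : ℝ) < k n := by exact_mod_cast hkn
    have : 1 - x n ≤ B / k n := by rw [le_div_iff₀ hkn']; linarith
    rw [neg_div]
    linarith
  have hl : 0 < l := by
    refine (Real.exp_pos (-B)).trans_le
      (le_of_tendsto_of_tendsto ((Real.tendsto_one_add_div_pow_exp (-B)).comp hk) h ?_)
    filter_upwards [hpos, hle] with n h1 h2
    exact pow_le_pow_left₀ h1.le h2 _
  refine ⟨hl, tendsto_natCast_mul_one_sub_of_tendsto_pow hk hl ?_ h⟩
  filter_upwards [hpos, hle] with n h1 h2 using h1.trans_le h2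

lemma integral_one_sub_exp_eq_gaussian (μ : Measure ℝ) [IsProbabilityMeasure μ] {a : ℝ}
    (ha : 0 < a) : ∫ t, (1 - Real.exp (-(a * t ^ 2))) ∂μ =
      ∫ g, (1 - ∫ t, Real.cos (√(2 * a) * g * t) ∂μ) ∂(gaussianReal 0 1) := by
  have hgauss : ∀ t : ℝ, 1 - Real.exp (-(a * t ^ 2)) =
      ∫ g, (1 - Real.cos (√(2 * a) * g * t)) ∂(gaussianReal 0 1) := by
    intro t
    have h1 := re_charFun (gaussianReal 0 1) (√(2 * a) * t)
    rw [charFun_gaussianReal] at h1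
    have h2 : ((√(2 * a) * t : ℝ) : ℂ) * ((0 : ℝ) : ℂ) * Complex.I -
        ((1 : NNReal) : ℝ) * ((√(2 * a) * t : ℝ) : ℂ) ^ 2 / 2 = ((-(a * t ^ 2) : ℝ) : ℂ) := by
      rw [← Complex.ofReal_pow, mul_pow, Real.sq_sqrt (by positivity)]
      push_cast
      ring
    rw [h2, Complex.exp_ofReal_re] at h1
    rw [h1, ← integral_one_sub_cos]
    congr 1 with g
    ring_nf
  simp_rw [hgauss]
  rw [integral_integral_swap]
  · congr 1 with g
    exact integral_one_sub_cos μ _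
  · refine Integrable.of_bound (by fun_prop) 2 (ae_of_all _ fun p => ?_)
    simp only [Function.uncurry, Real.norm_eq_abs]
    rw [abs_le]
    constructor <;> linarith [Real.cos_le_one (√(2 * a) * p.2 * p.1),
      Real.neg_one_le_cos (√(2 * a) * p.2 * p.1)]

lemma integrable_sq_abs_div_add_one_gaussianReal (c η K : ℝ) :
    Integrable (fun g : ℝ => (|c * g| / η + 1) ^ 2 * K) (gaussianReal 0 1) := by
  refine Integrable.mul_const ?_ K
  have h1 : MemLp (fun g : ℝ => |c * g| / η + 1) 2 (gaussianReal 0 1) := by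
    have h2 : MemLp (fun g : ℝ => c * g) 2 (gaussianReal 0 1) :=
      (memLp_id_gaussianReal 2).const_mul c
    have h3 : MemLp (fun g : ℝ => |c * g| / η) 2 (gaussianReal 0 1) := by
      simpa [div_eq_mul_inv, mul_comm] using h2.norm.const_mul η⁻¹
    exact h3.add (memLp_const 1)
  exact h1.integrable_sq

lemma continuous_integral_cos (μ : Measure ℝ) [IsFiniteMeasure μ] :
    Continuous fun s => ∫ x, Real.cos (s * x) ∂μ := by
  simp_rw [← re_charFun]
  exact Complex.continuous_re.comp continuous_charFun

lemma exists_laplace_of_weakTendsto (hsym : ∀ n, (ν n).map (fun x => -x) = ν n)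
    (hk : Tendsto k atTop atTop) {μ : Measure ℝ} [IsProbabilityMeasure μ]
    (h : WeakTendsto (fun n => convPow (ν n) (k n)) μ) :
    ∃ Ψ : ℝ → ℝ, (∀ a > 0, Tendsto
      (fun n => (k n : ℝ) * ∫ t, (1 - Real.exp (-(a * t ^ 2))) ∂(ν n)) atTop (𝓝 (Ψ a))) ∧
      Tendsto Ψ (𝓝[>] 0) (𝓝 0) := by
  obtain ⟨K, η, hK, hη, hbound⟩ := exists_eventually_one_sub_integral_cos_le hsym hk h
  have hlim := fun s => pos_and_tendsto_of_eventually_le hk (hbound.mono fun n hn => hn s)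
    (tendsto_integral_cos_pow hsym h s)
  have hnonneg : ∀ n s, 0 ≤ (k n : ℝ) * (1 - ∫ t, Real.cos (s * t) ∂(ν n)) := fun n s =>
    mul_nonneg (Nat.cast_nonneg _)
      (by linarith [(abs_le.1 (abs_integral_cos_le_one (ν n) s)).2])
  set ψ : ℝ → ℝ := fun s => -Real.log (∫ x, Real.cos (s * x) ∂μ) with hψ
  have hψ_cont : Continuous ψ :=
    ((continuous_integral_cos μ).log fun s => (hlim s).1.ne').neg
  have hψ_bound : ∀ s, |ψ s| ≤ (|s| / η + 1) ^ 2 * K := fun s => by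
    rw [abs_of_nonneg (ge_of_tendsto' (hlim s).2 fun n => hnonneg n s)]
    exact le_of_tendsto (hlim s).2 (hbound.mono fun n hn => hn s)
  refine ⟨fun a => ∫ g, ψ (√(2 * a) * g) ∂(gaussianReal 0 1), fun a ha => ?_, ?_⟩
  · simp_rw [integral_one_sub_exp_eq_gaussian _ ha, ← integral_const_mul]
    refine tendsto_integral_filter_of_dominated_convergence _ ?_ ?_
      (integrable_sq_abs_div_add_one_gaussianReal √(2 * a) η K)
      (ae_of_all _ fun g => (hlim _).2)
    · refine Eventually.of_forall fun n => Continuous.aestronglyMeasurable ?_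
      have := (continuous_integral_cos (ν n)).comp (continuous_const_mul √(2 * a))
      exact (continuous_const.sub this).const_mul _
    · filter_upwards [hbound] with n hn
      refine ae_of_all _ fun g => ?_
      rw [Real.norm_eq_abs, abs_of_nonneg (hnonneg n _)]
      exact hn _
  · have hψ0 : ψ 0 = 0 := by simp [hψ]
    have : Tendsto (fun a => ∫ g, ψ (√(2 * a) * g) ∂(gaussianReal 0 1)) (𝓝[>] 0)
        (𝓝 (∫ _, (0 : ℝ) ∂(gaussianReal 0 1))) := by
      refine tendsto_integral_filter_of_dominated_convergence _
        (Eventually.of_forall fun a => by fun_prop) ?_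
        (integrable_sq_abs_div_add_one_gaussianReal 2 η K) (ae_of_all _ fun g => ?_)
      · have hlt : ∀ᶠ a : ℝ in 𝓝[>] 0, a < 2 := mem_nhdsWithin_of_mem_nhds (Iio_mem_nhds two_pos)
        filter_upwards [hlt] with a ha
        refine ae_of_all _ fun g => (hψ_bound _).trans ?_
        have h2 : √(2 * a) ≤ 2 := Real.sqrt_le_iff.2 ⟨by norm_num, by linarith⟩
        rw [abs_mul, abs_mul, abs_of_nonneg (Real.sqrt_nonneg _), abs_two]
        gcongr
      · have hc : Continuous fun a : ℝ => ψ (√(2 * a) * g) := by fun_prop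
        have := (hc.tendsto 0).mono_left (nhdsWithin_le_nhds (s := Set.Ioi 0))
        simpa [hψ0] using this
    simpa using this

end LaplaceExponent

/-- for a sequence `(ν_n)` of symmetric probability measures on `ℝ`,
`(k_n) → ∞`, and `ρ_n` the pushforward of `ν_n` by `t ↦ t²`, the sequence `(ν_n^{*k_n})`
converges weakly to some probability measure iff `(ρ_n^{*k_n})` does. -/
theorem stmt16 (ν : ℕ → Measure ℝ) (hprob : ∀ n, IsProbabilityMeasure (ν n))
    (hsym : ∀ n, (ν n).map (fun x => -x) = ν n)
    (k : ℕ → ℕ) (hk : Tendsto k atTop atTop) :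
    (∃ μ : Measure ℝ, IsProbabilityMeasure μ ∧
        WeakTendsto (fun n => convPow (ν n) (k n)) μ) ↔
    (∃ ρ : Measure ℝ, IsProbabilityMeasure ρ ∧
        WeakTendsto (fun n => convPow ((ν n).map (fun t => t^2)) (k n)) ρ) := by
  constructor
  · rintro ⟨μ, hμ, h⟩
    obtain ⟨Ψ, hΨ, hΨ0⟩ := exists_laplace_of_weakTendsto hsym hk h
    exact exists_weakTendsto_convPow_map_sq_of_laplace hk hΨ hΨ0
  · rintro ⟨ρ, hρ, h⟩
    obtain ⟨Ψ, hΨ, hΨ0⟩ := exists_laplace_of_weakTendsto_map_sq hk h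
    exact exists_weakTendsto_convPow_of_laplace hsym hk hΨ hΨ0
end

section
/- Let G be a symmetric positive finite measure on ℝ. Then for every z ∈ ℂ∖[0,∞), z·∫_ℝ (1+t²)/(1−zt²) dG(t) = ∫_ℝ (z + t√z)/(1 − t√z) dG(t), where √· denotes the analytic branch of the square root on ℂ∖[0,∞) with √(−1) = i. -/
open MeasureTheory Complex

/-- The branch of the square root on `ℂ ∖ [0,∞)` with `√(-1) = i`. -/
noncomputable def sqrtCut (z : ℂ) : ℂ := Complex.I * (-z) ^ ((1:ℂ)/2)

theorem sqrtCut_sq (z : ℂ) : sqrtCut z ^ 2 = z := by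
  have h : ((-z) ^ ((1 : ℂ) / 2)) ^ 2 = -z := by
    rw [← Complex.cpow_nat_mul]
    norm_num
  rw [sqrtCut, mul_pow, h, Complex.I_sq]
  ring

theorem sqrtCut_im_ne_zero {z : ℂ} (hz : ¬(z.im = 0 ∧ 0 ≤ z.re)) : (sqrtCut z).im ≠ 0 := by
  intro h
  apply hz
  rw [← sqrtCut_sq z, sq, Complex.mul_im, Complex.mul_re, h]
  simp [mul_self_nonneg]

theorem one_sub_ofReal_mul_ne_zero {s : ℂ} (hs : s.im ≠ 0) (t : ℝ) : 1 - (t : ℂ) * s ≠ 0 := by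
  intro h
  have him := congrArg Complex.im h
  simp only [sub_im, one_im, im_ofReal_mul, zero_im, zero_sub, neg_eq_zero, mul_eq_zero, hs,
    or_false] at him
  simp [him] at h

theorem norm_inv_one_sub_ofReal_mul_le {s : ℂ} (hs : s.im ≠ 0) (t : ℝ) :
    ‖(1 - (t : ℂ) * s)⁻¹‖ ≤ ‖s‖ / |s.im| := by
  have hpos : 0 < ‖1 - (t : ℂ) * s‖ := norm_pos_iff.mpr (one_sub_ofReal_mul_ne_zero hs t)
  have him : |s.im| ≤ ‖(1 - (t : ℂ) * s) * (starRingEnd ℂ) s‖ := by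
    refine le_trans (le_of_eq ?_) (Complex.abs_im_le_norm _)
    rw [← abs_neg]
    congr 1
    simp
    ring
  rw [norm_mul, RCLike.norm_conj] at him
  rw [norm_inv, inv_eq_one_div, div_le_div_iff₀ hpos (abs_pos.mpr hs)]
  linarith

theorem integrable_add_div_one_sub (G : Measure ℝ) [IsFiniteMeasure G] (z : ℂ) {s : ℂ}
    (hs : s.im ≠ 0) :
    Integrable (fun t : ℝ => (z + (t : ℂ) * s) / (1 - (t : ℂ) * s)) G := by
  have hinv : Integrable (fun t : ℝ => (1 - (t : ℂ) * s)⁻¹) G :=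
    .of_bound (by fun_prop) (‖s‖ / |s.im|)
      (.of_forall fun t => norm_inv_one_sub_ofReal_mul_le hs t)
  refine ((hinv.const_mul (1 + z)).sub (integrable_const 1)).congr (.of_forall fun t => ?_)
  have h := one_sub_ofReal_mul_ne_zero hs t
  simp only [Pi.sub_apply]
  field_simp
  ring

/-- for a symmetric positive finite measure `G` on `ℝ` and `z ∈ ℂ ∖ [0,∞)`,
`z·∫ (1+t²)/(1−zt²) dG(t) = ∫ (z + t√z)/(1 − t√z) dG(t)`. -/
theorem stmt19 (G : Measure ℝ) [IsFiniteMeasure G]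
    (hGsym : G.map (fun x => -x) = G)
    (z : ℂ) (hz : ¬(z.im = 0 ∧ 0 ≤ z.re)) :
    z * ∫ t : ℝ, (1 + (t:ℂ)^2) / (1 - z * (t:ℂ)^2) ∂G =
      ∫ t : ℝ, (z + (t:ℂ) * sqrtCut z) / (1 - (t:ℂ) * sqrtCut z) ∂G := by
  set s := sqrtCut z
  have hsq : s ^ 2 = z := sqrtCut_sq z
  have hs : s.im ≠ 0 := sqrtCut_im_ne_zero hz
  let f : ℝ → ℂ := fun t => (z + (t : ℂ) * s) / (1 - (t : ℂ) * s)
  have hf : Integrable f G := integrable_add_div_one_sub G z hs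
  have hG : MeasurePreserving (fun x : ℝ => -x) G G := ⟨measurable_neg, hGsym⟩
  have hneg : ∫ t, f (-t) ∂G = ∫ t, f t ∂G :=
    hG.integral_comp (MeasurableEquiv.neg ℝ).measurableEmbedding f
  have hf_neg : Integrable (fun t => f (-t)) G := hG.integrable_comp_of_integrable hf
  have hsymm : ∀ t : ℝ,
      z * ((1 + (t : ℂ) ^ 2) / (1 - z * (t : ℂ) ^ 2)) = 2⁻¹ * (f t + f (-t)) := by
    intro t
    have h₁ := one_sub_ofReal_mul_ne_zero hs t
    have h₂ := one_sub_ofReal_mul_ne_zero hs (-t)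
    have hprod : 1 - z * (t : ℂ) ^ 2 = (1 - (t : ℂ) * s) * (1 - ((-t : ℝ) : ℂ) * s) := by
      rw [← hsq]
      push_cast
      ring
    simp only [f]
    rw [hprod, div_add_div _ _ h₁ h₂, mul_div_assoc', mul_div_assoc']
    congr 1
    rw [← hsq]
    push_cast
    ring
  rw [← integral_const_mul]
  simp_rw [hsymm]
  rw [integral_const_mul, integral_add hf hf_neg, hneg]
  ring
end
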